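/- arXiv:2403.18801 — 11 statements merged into one kernel-verified Lean document; each statement's English description precedes it below -/
import Mathlib

section
/- Let α, β be real numbers with α ≠ 0 and β ≠ 0, and let x : ℝ → ℝ be twice differentiable with α·x(t) + β·x'(t) ≠ 0 for all t. Then x satisfies the Euler–Lagrange equation for the reciprocal Lagrangian L(x,v) = (αx + βv)⁻¹ (i.e., for all t, d/dt[−β(αx(t)+βx'(t))⁻²] = −α(αx(t)+βx'(t))⁻²) if and only if for all t, x''(t) + (3α/(2β))·x'(t) + (α²/(2β²))·x(t) = 0. -/
/-- Euler–Lagrange equation for the reciprocal Lagrangian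
`L(x,v) = (αx + βv)⁻¹` is equivalent to the damped harmonic oscillator
equation `x'' + (3α/(2β)) x' + (α²/(2β²)) x = 0`. -/
theorem reciprocal_lagrangian_euler_lagrange_iff_damped_oscillator
    (α β : ℝ) (hα : α ≠ 0) (hβ : β ≠ 0) (x : ℝ → ℝ)
    (hx : Differentiable ℝ x) (hx' : Differentiable ℝ (deriv x))
    (hne : ∀ t, α * x t + β * deriv x t ≠ 0) :
    (∀ t, deriv (fun s => -β * ((α * x s + β * deriv x s) ^ 2)⁻¹) t
        = -α * ((α * x t + β * deriv x t) ^ 2)⁻¹) ↔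
    (∀ t, deriv (deriv x) t + (3 * α / (2 * β)) * deriv x t
        + (α ^ 2 / (2 * β ^ 2)) * x t = 0) := by
  refine forall_congr' fun t => ?_
  have hu : HasDerivAt (fun s => α * x s + β * deriv x s)
      (α * deriv x t + β * deriv (deriv x) t) t :=
    ((hx t).hasDerivAt.const_mul α).add ((hx' t).hasDerivAt.const_mul β)
  have hL := ((hu.fun_pow 2).fun_inv (pow_ne_zero 2 (hne t))).const_mul (-β)
  have hfactor : -β * (-(((2 : ℕ) : ℝ) * (α * x t + β * deriv x t) ^ (2 - 1)
        * (α * deriv x t + β * deriv (deriv x) t)) / ((α * x t + β * deriv x t) ^ 2) ^ 2)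
      - -α * ((α * x t + β * deriv x t) ^ 2)⁻¹
      = 2 * β ^ 2 / (α * x t + β * deriv x t) ^ 3
        * (deriv (deriv x) t + (3 * α / (2 * β)) * deriv x t
          + (α ^ 2 / (2 * β ^ 2)) * x t) := by
    have hut := hne t
    field_simp
    push_cast
    ring
  have hcoeff : 2 * β ^ 2 / (α * x t + β * deriv x t) ^ 3 ≠ 0 :=
    div_ne_zero (mul_ne_zero two_ne_zero (pow_ne_zero 2 hβ)) (pow_ne_zero 3 (hne t))
  rw [hL.deriv, ← sub_eq_zero, hfactor, mul_eq_zero, or_iff_right hcoeff]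
end

section
/- Let α, β be nonzero real numbers, μ : ℝ → ℝ a differentiable function, and x : ℝ → ℝ twice differentiable with α·μ(x(t)) + β·x'(t) ≠ 0 for all t. Then x satisfies the Euler–Lagrange equation for the reciprocal Lagrangian L(x,v) = (αμ(x) + βv)⁻¹ (i.e., for all t, d/dt[−β(αμ(x(t))+βx'(t))⁻²] = −αμ'(x(t))(αμ(x(t))+βx'(t))⁻²) if and only if for all t, x''(t) + (3α·μ'(x(t))/(2β))·x'(t) + (α²·μ'(x(t))·μ(x(t))/(2β²)) = 0. -/
/-- Euler–Lagrange equation for the reciprocal Lagrangian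
`L(x,v) = (αμ(x) + βv)⁻¹` is equivalent to the Liénard-type equation
`x'' + (3αμ'(x)/(2β)) x' + (α²μ'(x)μ(x)/(2β²)) = 0`. -/
theorem reciprocal_lagrangian_general_euler_lagrange_iff
    (α β : ℝ) (hα : α ≠ 0) (hβ : β ≠ 0) (μ : ℝ → ℝ) (hμ : Differentiable ℝ μ)
    (x : ℝ → ℝ) (hx : Differentiable ℝ x) (hx' : Differentiable ℝ (deriv x))
    (hne : ∀ t, α * μ (x t) + β * deriv x t ≠ 0) :
    (∀ t, deriv (fun s => -β * ((α * μ (x s) + β * deriv x s) ^ 2)⁻¹) t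
        = -α * deriv μ (x t) * ((α * μ (x t) + β * deriv x t) ^ 2)⁻¹) ↔
    (∀ t, deriv (deriv x) t + (3 * α * deriv μ (x t) / (2 * β)) * deriv x t
        + α ^ 2 * deriv μ (x t) * μ (x t) / (2 * β ^ 2) = 0) := by
  refine forall_congr' fun t => ?_
  have hw : HasDerivAt (fun s => α * μ (x s) + β * deriv x s)
      (α * (deriv μ (x t) * deriv x t) + β * deriv (deriv x) t) t :=
    (((hμ (x t)).hasDerivAt.comp t (hx t).hasDerivAt).const_mul α).add
      ((hx' t).hasDerivAt.const_mul β)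
  have hd := (((hw.fun_pow 2).fun_inv (pow_ne_zero 2 (hne t))).const_mul (-β)).deriv
  have hw0 := hne t
  rw [hd, ← sub_eq_zero]
  generalize deriv (deriv x) t = a, deriv μ (x t) = m', μ (x t) = m, deriv x t = v at hw0 ⊢
  have key : -β * (-(((2 : ℕ) : ℝ) * (α * m + β * v) ^ (2 - 1) * (α * (m' * v) + β * a))
        / ((α * m + β * v) ^ 2) ^ 2) - -α * m' * ((α * m + β * v) ^ 2)⁻¹
      = 2 * β ^ 2 / (α * m + β * v) ^ 3 *
        (a + (3 * α * m' / (2 * β)) * v + α ^ 2 * m' * m / (2 * β ^ 2)) := by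
    push_cast
    field_simp
    ring
  have hc : 2 * β ^ 2 / (α * m + β * v) ^ 3 ≠ 0 := by positivity
  rw [key, mul_eq_zero, or_iff_right hc]
end

section
/- Let γ, δ be nonzero real numbers, μ : ℝ → ℝ a differentiable function, and x : ℝ → ℝ twice differentiable with γ·μ(x(t)) + δ·x'(t) > 0 for all t. Then x satisfies the Euler–Lagrange equation for the logarithmic Lagrangian L(x,v) = ln(γμ(x) + δv) (i.e., for all t, d/dt[δ/(γμ(x(t))+δx'(t))] = γμ'(x(t))/(γμ(x(t))+δx'(t))) if and only if for all t, x''(t) + (2γ·μ'(x(t))/δ)·x'(t) + (γ²·μ(x(t))·μ'(x(t))/δ²) = 0. -/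
/-- Euler–Lagrange equation for the logarithmic Lagrangian
`L(x,v) = ln(γμ(x) + δv)` is equivalent to the Liénard-type equation
`x'' + (2γμ'(x)/δ) x' + (γ²μ(x)μ'(x)/δ²) = 0`. -/
theorem logarithmic_lagrangian_euler_lagrange_iff
    (γ δ : ℝ) (hγ : γ ≠ 0) (hδ : δ ≠ 0) (μ : ℝ → ℝ) (hμ : Differentiable ℝ μ)
    (x : ℝ → ℝ) (hx : Differentiable ℝ x) (hx' : Differentiable ℝ (deriv x))
    (hpos : ∀ t, γ * μ (x t) + δ * deriv x t > 0) :
    (∀ t, deriv (fun s => δ / (γ * μ (x s) + δ * deriv x s)) t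
        = γ * deriv μ (x t) / (γ * μ (x t) + δ * deriv x t)) ↔
    (∀ t, deriv (deriv x) t + (2 * γ * deriv μ (x t) / δ) * deriv x t
        + γ ^ 2 * μ (x t) * deriv μ (x t) / δ ^ 2 = 0) := by
  refine forall_congr' fun t => ?_
  have hD : γ * μ (x t) + δ * deriv x t ≠ 0 := (hpos t).ne'
  have hμx : HasDerivAt (fun s => μ (x s)) (deriv μ (x t) * deriv x t) t :=
    (hμ (x t)).hasDerivAt.comp t (hx t).hasDerivAt
  have hden : HasDerivAt (fun s => γ * μ (x s) + δ * deriv x s)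
      (γ * (deriv μ (x t) * deriv x t) + δ * deriv (deriv x) t) t :=
    (hμx.const_mul γ).add ((hx' t).hasDerivAt.const_mul δ)
  have hquot : deriv (fun s => δ / (γ * μ (x s) + δ * deriv x s)) t =
      -(δ * (γ * (deriv μ (x t) * deriv x t) + δ * deriv (deriv x) t)) /
        (γ * μ (x t) + δ * deriv x t) ^ 2 := by
    simpa using ((hasDerivAt_const t δ).fun_div hden hD).deriv
  have hdiff : δ ^ 2 * (deriv (deriv x) t + (2 * γ * deriv μ (x t) / δ) * deriv x t
      + γ ^ 2 * μ (x t) * deriv μ (x t) / δ ^ 2) =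
      γ * deriv μ (x t) * (γ * μ (x t) + δ * deriv x t) +
        δ * (γ * (deriv μ (x t) * deriv x t) + δ * deriv (deriv x) t) := by
    field_simp
    ring
  rw [hquot, div_eq_div_iff (pow_ne_zero 2 hD) hD, pow_two,
    ← mul_assoc (γ * deriv μ (x t)), mul_left_inj' hD,
    ← mul_eq_zero_iff_left (pow_ne_zero 2 hδ), hdiff]
  constructor <;> intro h <;> linarith
end

section
/- Let α, β be nonzero real numbers, μ : ℝ → ℝ differentiable, ρ : ℝ → ℝ twice differentiable, and x : ℝ → ℝ twice differentiable such that for all t, α·μ(x(t)) + β·ρ(x'(t)) ≠ 0 and 2β²·ρ'(x'(t))² − β·ρ''(x'(t))·(αμ(x(t)) + βρ(x'(t))) ≠ 0. Then x satisfies the Euler–Lagrange equation for L(x,v) = (αμ(x) + βρ(v))⁻¹ (i.e., for all t, d/dt[−βρ'(x'(t))(αμ(x(t))+βρ(x'(t)))⁻²] = −αμ'(x(t))(αμ(x(t))+βρ(x'(t)))⁻²) if and only if for all t, x''(t) + A(x(t),x'(t))·x'(t) + B(x(t),x'(t)) = 0, where A(x,v) = 2αβρ'(v)μ'(x) / [2β²ρ'(v)²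 − βρ''(v)(αμ(x)+βρ(v))] and B(x,v) = αμ'(x)(αμ(x)+βρ(v)) / [2β²ρ'(v)² − βρ''(v)(αμ(x)+βρ(v))]. -/
/-- The derivative of the momentum `∂L/∂v` of `L(x,v) = (αμ(x) + βρ(v))⁻¹` along a curve `x`. -/
theorem hasDerivAt_reciprocal_lagrangian_momentum
    {α β t : ℝ} {μ ρ x : ℝ → ℝ} (hμ : DifferentiableAt ℝ μ (x t))
    (hρ : DifferentiableAt ℝ ρ (deriv x t)) (hρ' : DifferentiableAt ℝ (deriv ρ) (deriv x t))
    (hx : DifferentiableAt ℝ x t) (hx' : DifferentiableAt ℝ (deriv x) t)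
    (hne : α * μ (x t) + β * ρ (deriv x t) ≠ 0) :
    HasDerivAt (fun s => -β * deriv ρ (deriv x s) * ((α * μ (x s) + β * ρ (deriv x s)) ^ 2)⁻¹)
      ((2 * β * deriv ρ (deriv x t)
            * (α * deriv μ (x t) * deriv x t + β * deriv ρ (deriv x t) * deriv (deriv x) t)
          - β * deriv (deriv ρ) (deriv x t) * deriv (deriv x) t
            * (α * μ (x t) + β * ρ (deriv x t)))
        / (α * μ (x t) + β * ρ (deriv x t)) ^ 3) t := by
  have hM := ((hμ.hasDerivAt.comp t hx.hasDerivAt).const_mul α).add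
    ((hρ.hasDerivAt.comp t hx'.hasDerivAt).const_mul β)
  have hP := (hρ'.hasDerivAt.comp t hx'.hasDerivAt).const_mul (-β)
  refine (hP.mul ((hM.pow 2).inv (pow_ne_zero 2 hne))).congr_deriv ?_
  simp only [Function.comp_apply, Pi.add_apply, Pi.pow_apply, Pi.inv_apply]
  field_simp
  ring

/-- Euler–Lagrange equation for the reciprocal Lagrangian
`L(x,v) = (αμ(x) + βρ(v))⁻¹` is equivalent to
`x'' + A(x,x') x' + B(x,x') = 0` with the indicated coefficients. -/
theorem reciprocal_lagrangian_velocity_function_euler_lagrange_iff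
    (α β : ℝ) (hα : α ≠ 0) (hβ : β ≠ 0)
    (μ : ℝ → ℝ) (hμ : Differentiable ℝ μ)
    (ρ : ℝ → ℝ) (hρ : Differentiable ℝ ρ) (hρ' : Differentiable ℝ (deriv ρ))
    (x : ℝ → ℝ) (hx : Differentiable ℝ x) (hx' : Differentiable ℝ (deriv x))
    (hne : ∀ t, α * μ (x t) + β * ρ (deriv x t) ≠ 0)
    (hden : ∀ t, 2 * β ^ 2 * (deriv ρ (deriv x t)) ^ 2
        - β * deriv (deriv ρ) (deriv x t) * (α * μ (x t) + β * ρ (deriv x t)) ≠ 0) :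
    (∀ t, deriv (fun s => -β * deriv ρ (deriv x s)
            * ((α * μ (x s) + β * ρ (deriv x s)) ^ 2)⁻¹) t
        = -α * deriv μ (x t) * ((α * μ (x t) + β * ρ (deriv x t)) ^ 2)⁻¹) ↔
    (∀ t, deriv (deriv x) t
        + (2 * α * β * deriv ρ (deriv x t) * deriv μ (x t)
            / (2 * β ^ 2 * (deriv ρ (deriv x t)) ^ 2
              - β * deriv (deriv ρ) (deriv x t) * (α * μ (x t) + β * ρ (deriv x t))))
          * deriv x t
        + (α * deriv μ (x t) * (α * μ (x t) + β * ρ (deriv x t))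
            / (2 * β ^ 2 * (deriv ρ (deriv x t)) ^ 2
              - β * deriv (deriv ρ) (deriv x t) * (α * μ (x t) + β * ρ (deriv x t))))
        = 0) := by
  refine forall_congr' fun t => ?_
  rw [(hasDerivAt_reciprocal_lagrangian_momentum (hμ _) (hρ _) (hρ' _) (hx t) (hx' t)
    (hne t)).deriv]
  have hM := hne t
  have hD := hden t
  generalize deriv (deriv x) t = a at *
  generalize deriv (deriv ρ) (deriv x t) = r₂ at *
  generalize deriv ρ (deriv x t) = r₁ at *
  generalize deriv μ (x t) = m₁ at *
  generalize α * μ (x t) + β * ρ (deriv x t) = M at *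
  generalize deriv x t = v at *
  generalize hDen : 2 * β ^ 2 * r₁ ^ 2 - β * r₂ * M = D at *
  have hres : (2 * β * r₁ * (α * m₁ * v + β * r₁ * a) - β * r₂ * a * M) / M ^ 3
        - -α * m₁ * (M ^ 2)⁻¹
      = D / M ^ 3 * (a + 2 * α * β * r₁ * m₁ / D * v + α * m₁ * M / D) := by
    field_simp
    rw [← hDen]
    ring
  rw [← sub_eq_zero, hres, mul_eq_zero, or_iff_right (div_ne_zero hD (pow_ne_zero 3 hM))]
end

section
/- Let f, g : ℝ → ℝ with f differentiable and never zero, g differentiable, and let ℓ be a nonzero real number such that the Cheillini condition holds: for all y, (d/dy)(g(y)/f(y)) + ℓ(ℓ+1)·f(y) = 0. Suppose x, u : ℝ → ℝ are differentiable and satisfy for all t: u'(t) = ℓ·u(t)·f(x(t)) and x'(t) = u(t) + g(x(t))/(ℓ·f(x(t))). Then x is twice differentiable and satisfies the Liénard equation x''(t) + f(x(t))·x'(t) + g(x(t)) = 0 for all t. -/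
/-- If the Cheillini condition holds and `(x, u)` solves the
first-order system `u' = ℓ u f(x)`, `x' = u + g(x)/(ℓ f(x))`, then `x`
is twice differentiable and satisfies the Liénard equation
`x'' + f(x) x' + g(x) = 0`. -/
theorem lienard_from_first_order_system
    (f g : ℝ → ℝ) (hf : Differentiable ℝ f) (hf0 : ∀ y, f y ≠ 0)
    (hg : Differentiable ℝ g) (ℓ : ℝ) (hℓ : ℓ ≠ 0)
    (hche : ∀ y, deriv (fun z => g z / f z) y + ℓ * (ℓ + 1) * f y = 0)
    (x u : ℝ → ℝ) (hx : Differentiable ℝ x) (hu : Differentiable ℝ u)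
    (h1 : ∀ t, deriv u t = ℓ * u t * f (x t))
    (h2 : ∀ t, deriv x t = u t + g (x t) / (ℓ * f (x t))) :
    Differentiable ℝ (deriv x) ∧
      ∀ t, deriv (deriv x) t + f (x t) * deriv x t + g (x t) = 0 := by
  have hx' : deriv x = fun t => u t + g (x t) / f (x t) / ℓ := by
    funext t
    rw [h2 t, div_div, mul_comm ℓ]
  have hderiv : ∀ t, HasDerivAt (deriv x)
      (ℓ * u t * f (x t) + -(ℓ * (ℓ + 1) * f (x t)) * deriv x t / ℓ) t := by
    intro t
    have hquot : HasDerivAt (fun z => g z / f z) (-(ℓ * (ℓ + 1) * f (x t))) (x t) := by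
      rw [← eq_neg_of_add_eq_zero_left (hche (x t))]
      exact ((hg (x t)).fun_div (hf (x t)) (hf0 (x t))).hasDerivAt
    have hu' : HasDerivAt u (ℓ * u t * f (x t)) t := h1 t ▸ (hu t).hasDerivAt
    have hsum := hu'.add ((hquot.comp t (hx t).hasDerivAt).div_const ℓ)
    exact hsum.congr_of_eventuallyEq (Filter.Eventually.of_forall fun s => congrFun hx' s)
  refine ⟨fun t => (hderiv t).differentiableAt, fun t => ?_⟩
  have hft := hf0 (x t)
  rw [(hderiv t).deriv, h2 t]
  field_simp
  ring
end

section
/- Let a ≠ 0, α ≠ −1, and ℓ be real numbers, and let g : (0,∞) → ℝ be differentiable. Then g satisfies the Cheillini ODE (d/dx)(x^(−α)·g(x)) + ℓ(ℓ+1)·a²·x^α = 0 for all x > 0 if and only if there exists a real constant k such that g(x) = k·x^α − (ℓ(ℓ+1)·a²/(α+1))·x^(2α+1) for all x > 0. -/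
open Set

lemma hasDerivAt_const_div_mul_rpow_add_one (c : ℝ) {α x : ℝ} (hα : α ≠ -1) (hx : 0 < x) :
    HasDerivAt (fun y : ℝ => c / (α + 1) * y ^ (α + 1)) (c * x ^ α) x := by
  have hα' : α + 1 ≠ 0 := fun h => hα (eq_neg_of_add_eq_zero_left h)
  have h := (Real.hasDerivAt_rpow_const (p := α + 1) (Or.inl hx.ne')).const_mul (c / (α + 1))
  rwa [add_sub_cancel_right, ← mul_assoc, div_mul_cancel₀ c hα'] at h

lemma rpow_neg_mul_eq_iff {x : ℝ} (hx : 0 < x) (α u k c : ℝ) :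
    x ^ (-α) * u = -c * x ^ (α + 1) + k ↔ u = k * x ^ α - c * x ^ (2 * α + 1) := by
  have hpos : 0 < x ^ α := Real.rpow_pos_of_pos hx α
  have h : x ^ (2 * α + 1) = x ^ α * x ^ (α + 1) := by
    rw [← Real.rpow_add hx]
    ring_nf
  rw [h, Real.rpow_neg hx.le, inv_mul_eq_iff_eq_mul₀ hpos.ne']
  ring_nf

/-- For `f(x) = a x^α`, the Cheillini ODE
`(d/dx)(x^(−α) g(x)) + ℓ(ℓ+1) a² x^α = 0` on `(0,∞)` holds iff
`g(x) = k x^α − (ℓ(ℓ+1)a²/(α+1)) x^(2α+1)` for some constant `k`. -/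
theorem cheillini_ode_solution_iff
    (a α ℓ : ℝ) (ha : a ≠ 0) (hα : α ≠ -1) (g : ℝ → ℝ)
    (hg : ∀ x > 0, DifferentiableAt ℝ g x) :
    (∀ x > 0, deriv (fun y : ℝ => y ^ (-α) * g y) x
        + ℓ * (ℓ + 1) * a ^ 2 * x ^ α = 0) ↔
    (∃ k : ℝ, ∀ x > 0,
        g x = k * x ^ α - (ℓ * (ℓ + 1) * a ^ 2 / (α + 1)) * x ^ (2 * α + 1)) := by
  have hF : ∀ x > 0, DifferentiableAt ℝ (fun y : ℝ => y ^ (-α) * g y) x := fun x hx =>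
    (Real.differentiableAt_rpow_const_of_ne (-α) hx.ne').mul (hg x hx)
  have hP : ∀ x > 0, HasDerivAt
      (fun y : ℝ => -(ℓ * (ℓ + 1) * a ^ 2 / (α + 1)) * y ^ (α + 1))
      (-(ℓ * (ℓ + 1) * a ^ 2) * x ^ α) x := fun x hx => by
    simpa only [neg_div] using
      hasDerivAt_const_div_mul_rpow_add_one (-(ℓ * (ℓ + 1) * a ^ 2)) hα hx
  constructor
  · intro h
    obtain ⟨k, hk⟩ := isOpen_Ioi.exists_eq_add_of_deriv_eq (isPreconnected_Ioi (a := (0 : ℝ)))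
      (fun x hx => (hF x hx).differentiableWithinAt)
      (fun x hx => (hP x hx).differentiableAt.differentiableWithinAt)
      (fun x hx => by rw [(hP x hx).deriv]; linarith [h x hx])
    exact ⟨k, fun x hx => (rpow_neg_mul_eq_iff hx α (g x) k _).1 (hk hx)⟩
  · rintro ⟨k, hk⟩ x hx
    have heq := (eventually_gt_nhds hx).mono fun y hy =>
      (rpow_neg_mul_eq_iff hy α (g y) k _).2 (hk y hy)
    rw [(((hP x hx).add_const k).congr_of_eventuallyEq heq).deriv]
    ring
end

section
/- Let f, g : ℝ → ℝ with f differentiable and never zero and g differentiable, let ℓ be a real number with ℓ ∉ {0, −1, −1/2}, and suppose the Cheillini condition holds: for all y, (d/dy)(g(y)/f(y)) + ℓ(ℓ+1)·f(y) = 0. Set W(y) = g(y)/(ℓ·f(y)) and let L(x,v) = (ℓ²/((ℓ+1)(2ℓ+1)))·(v − W(x))^((2ℓ+1)/ℓ). Let x : ℝ → ℝ be twice differentiable with x'(t) − W(x(t)) > 0 for all t. If x satisfies the Euler–Lagrange equation for L, i.e., for all t, d/dt[(ℓ/(ℓ+1))·(x'(t) − W(x(t)))^((ℓ+1)/ℓ)]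 = −(ℓ/(ℓ+1))·W'(x(t))·(x'(t) − W(x(t)))^((ℓ+1)/ℓ), then x satisfies the Liénard equation x''(t) + f(x(t))·x'(t) + g(x(t)) = 0 for all t. -/
/-- Under the Cheillini condition, the Euler–Lagrange equation of
the nonstandard Lagrangian `L(x,v) = (ℓ²/((ℓ+1)(2ℓ+1))) (v − W(x))^((2ℓ+1)/ℓ)`,
with `W = g/(ℓ f)`, implies the Liénard equation `x'' + f(x) x' + g(x) = 0`. -/
theorem lienard_from_nonstandard_lagrangian
    (f g : ℝ → ℝ) (hf : Differentiable ℝ f) (hf0 : ∀ y, f y ≠ 0)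
    (hg : Differentiable ℝ g) (ℓ : ℝ) (h0 : ℓ ≠ 0) (h1 : ℓ ≠ -1) (h2 : ℓ ≠ -1/2)
    (hche : ∀ y, deriv (fun z => g z / f z) y + ℓ * (ℓ + 1) * f y = 0)
    (W : ℝ → ℝ) (hW : ∀ y, W y = g y / (ℓ * f y))
    (x : ℝ → ℝ) (hx : Differentiable ℝ x) (hx' : Differentiable ℝ (deriv x))
    (hpos : ∀ t, deriv x t - W (x t) > 0)
    (hEL : ∀ t, deriv (fun s => (ℓ / (ℓ + 1)) * (deriv x s - W (x s)) ^ ((ℓ + 1) / ℓ)) t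
        = -(ℓ / (ℓ + 1)) * deriv W (x t) * (deriv x t - W (x t)) ^ ((ℓ + 1) / ℓ)) :
    ∀ t, deriv (deriv x) t + f (x t) * deriv x t + g (x t) = 0 := by
  have hW_deriv : ∀ y, HasDerivAt W (-(ℓ + 1) * f y) y := by
    intro y
    have hW_eq : W = fun z => ℓ⁻¹ * (g z / f z) := by
      funext z
      rw [hW z]
      field_simp
    have hq : HasDerivAt (fun z => g z / f z) (-(ℓ * (ℓ + 1) * f y)) y := by
      rw [← eq_neg_of_add_eq_zero_left (hche y)]
      exact ((hg y).fun_div (hf y) (hf0 y)).hasDerivAt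
    rw [hW_eq]
    refine (hq.const_mul ℓ⁻¹).congr_deriv ?_
    field_simp
  intro t
  have hl : ℓ + 1 ≠ 0 := fun h => h1 (eq_neg_of_add_eq_zero_left h)
  have hu : HasDerivAt (fun s => deriv x s - W (x s))
      (deriv (deriv x) t - -(ℓ + 1) * f (x t) * deriv x t) t :=
    (hx' t).hasDerivAt.sub ((hW_deriv (x t)).comp t (hx t).hasDerivAt)
  have hEL_t := hEL t
  rw [((hu.rpow_const (p := (ℓ + 1) / ℓ) (Or.inl (hpos t).ne')).const_mul _).deriv,
    (hW_deriv (x t)).deriv, Real.rpow_sub_one (hpos t).ne'] at hEL_t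
  have hpow := (Real.rpow_pos_of_pos (hpos t) ((ℓ + 1) / ℓ)).ne'
  have hgW : g (x t) = ℓ * f (x t) * W (x t) := by
    rw [hW, mul_div_cancel₀ _ (mul_ne_zero h0 (hf0 _))]
  have hu_ne := (hpos t).ne'
  generalize (deriv x t - W (x t)) ^ ((ℓ + 1) / ℓ) = P at hEL_t hpow
  field_simp at hEL_t
  rw [hgW]
  linear_combination hEL_t
end

section
/- Let H(x,p) = p³/12 − p·(1 − x²)/2, and let x, p : ℝ → ℝ be differentiable functions satisfying Hamilton's equations: for all t, x'(t) = (∂H/∂p)(x(t),p(t)) = p(t)²/4 − (1 − x(t)²)/2 and p'(t) = −(∂H/∂x)(x(t),p(t)) = −p(t)·x(t). Then x is twice differentiable and satisfies the Liénard equation x''(t) + x(t)·x'(t) + x(t) − x(t)³ = 0 for all t. -/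
/-- Hamilton's equations for `H(x,p) = p³/12 − p(1 − x²)/2`
imply the Liénard equation `x'' + x x' + x − x³ = 0`. -/
theorem hamilton_equations_give_lienard
    (x p : ℝ → ℝ) (hx : Differentiable ℝ x) (hp : Differentiable ℝ p)
    (h1 : ∀ t, deriv x t = (p t) ^ 2 / 4 - (1 - (x t) ^ 2) / 2)
    (h2 : ∀ t, deriv p t = -(p t * x t)) :
    Differentiable ℝ (deriv x) ∧
      ∀ t, deriv (deriv x) t + x t * deriv x t + x t - (x t) ^ 3 = 0 := by
  have hderiv : ∀ t, HasDerivAt (deriv x) (p t * deriv p t / 2 + x t * deriv x t) t := by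
    intro t
    rw [funext h1]
    refine ((((hp t).hasDerivAt.pow 2).div_const 4).sub
      ((((hx t).hasDerivAt.pow 2).const_sub 1).div_const 2)).congr_deriv ?_
    rw [← funext h1]
    push_cast
    ring
  refine ⟨fun t => (hderiv t).differentiableAt, fun t => ?_⟩
  rw [(hderiv t).deriv, h2 t, h1 t]
  ring
end

section
/- Let k be a positive integer, C = ((2k+1)/(2k−1))·(1/4)^(2/(2k+1)), and V : ℝ → ℝ. On the branch v < 1, interpret the Lagrangian with the real odd root, L(x,v) = −C·(1−v)^((2k−1)/(2k+1)) − V(x). For every p > 0, the velocity v = 1 − (1/4)·p^(−(2k+1)/2) satisfies v < 1, the momentum relation (1/4)^(2/(2k+1))·(1−v)^(−2/(2k+1)) = p, and the Legendre transform gives the second Hamiltonian branch p·v + C·(1−v)^((2k−1)/(2k+1)) + V(x) = p + (1/(4k−2))·p^(−(2k−1)/2) + V(x). -/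
theorem Real.rpow_mul_mul_rpow_rpow {c p : ℝ} (hc : 0 < c) (hp : 0 < p) (s r t : ℝ) :
    c ^ s * (c * p ^ r) ^ t = c ^ (s + t) * p ^ (r * t) := by
  rw [Real.mul_rpow hc.le (Real.rpow_nonneg hp.le r), ← Real.rpow_mul hp.le, Real.rpow_add hc]
  ring

/-- For the Curtright–Zachos Lagrangian on the branch `v < 1`,
interpreted with the real odd root, `L(x,v) = −C(1−v)^((2k−1)/(2k+1)) − V(x)`,
the velocity `v = 1 − (1/4) p^(−(2k+1)/2)` solves the momentum relation and
yields the second Hamiltonian branch `p + (1/(4k−2)) p^(−(2k−1)/2) + V(x)`. -/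
theorem curtright_zachos_hamiltonian_branch_minus
    (k : ℕ) (hk : 0 < k) (V : ℝ → ℝ) (x p : ℝ) (hp : 0 < p) :
    let C : ℝ := ((2 * (k : ℝ) + 1) / (2 * (k : ℝ) - 1))
        * (1 / 4 : ℝ) ^ ((2 : ℝ) / (2 * (k : ℝ) + 1))
    let v : ℝ := 1 - (1 / 4) * p ^ (-((2 * (k : ℝ) + 1) / 2))
    v < 1 ∧
    (1 / 4 : ℝ) ^ ((2 : ℝ) / (2 * (k : ℝ) + 1))
        * (1 - v) ^ (-((2 : ℝ) / (2 * (k : ℝ) + 1))) = p ∧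
    p * v + C * (1 - v) ^ ((2 * (k : ℝ) - 1) / (2 * (k : ℝ) + 1)) + V x
        = p + (1 / (4 * (k : ℝ) - 2)) * p ^ (-((2 * (k : ℝ) - 1) / 2)) + V x := by
  intro C v
  have hk1 : (1 : ℝ) ≤ k := by exact_mod_cast hk
  have ha : 2 * (k : ℝ) + 1 ≠ 0 := by linarith
  have hb : 2 * (k : ℝ) - 1 ≠ 0 := by linarith
  have hq : (0 : ℝ) < 1 / 4 := by norm_num
  have hv : 1 - v = (1 / 4) * p ^ (-((2 * (k : ℝ) + 1) / 2)) := sub_sub_cancel _ _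
  refine ⟨sub_pos.mp (hv ▸ by positivity), ?_, ?_⟩
  · rw [hv, Real.rpow_mul_mul_rpow_rpow hq hp, add_neg_cancel, Real.rpow_zero, one_mul,
      show -((2 * (k : ℝ) + 1) / 2) * -(2 / (2 * (k : ℝ) + 1)) = 1 by field_simp, Real.rpow_one]
  · have hC : C * (1 - v) ^ ((2 * (k : ℝ) - 1) / (2 * (k : ℝ) + 1))
        = (2 * (k : ℝ) + 1) / (2 * (k : ℝ) - 1)
          * ((1 / 4) * p ^ (-((2 * (k : ℝ) - 1) / 2))) := by
      rw [hv, mul_assoc, Real.rpow_mul_mul_rpow_rpow hq hp,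
        show (2 : ℝ) / (2 * k + 1) + (2 * k - 1) / (2 * k + 1) = 1 by field_simp; ring,
        show -((2 * (k : ℝ) + 1) / 2) * ((2 * k - 1) / (2 * k + 1)) = -((2 * k - 1) / 2) by
          field_simp, Real.rpow_one]
    have hpv : p * v = p - (1 / 4) * p ^ (-((2 * (k : ℝ) - 1) / 2)) := by
      rw [show -((2 * (k : ℝ) - 1) / 2) = 1 + -((2 * (k : ℝ) + 1) / 2) by ring,
        Real.rpow_add hp, Real.rpow_one]
      simp only [v]
      ring
    rw [hC, hpv, show 4 * (k : ℝ) - 2 = 2 * (2 * k - 1) by ring]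
    field_simp
    ring
end

section
/- Let m be a real number with 0 ≤ m < 1/2, δ > 0, σ : ℝ → ℝ, and set Λ = ((1−2m)/(1+2m))·δ^(2/(1−2m)). Consider the Lagrangian L(x,v) = Λ·(v + σ(x))^((2m+1)/(2m−1)) − δ on the branch v + σ(x) > 0. For every p < 0 and every real x, the velocity v = −σ(x) + δ·(−p)^((2m−1)/2) satisfies v + σ(x) > 0, the momentum relation −δ^(2/(1−2m))·(v+σ(x))^(2/(2m−1)) = p, and the Legendre transform gives the Hamiltonian branch p·v − L(x,v) = (−p)·σ(x) − (2δ/(2m+1))·(−p)^((2m+1)/2) + δ. -/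
/-- For the Lagrangian `L(x,v) = Λ(v + σ(x))^((2m+1)/(2m−1)) − δ`
on the branch `v + σ(x) > 0`, with `0 ≤ m < 1/2`, `δ > 0` and
`Λ = ((1−2m)/(1+2m)) δ^(2/(1−2m))`, the velocity
`v = −σ(x) + δ(−p)^((2m−1)/2)` solves the momentum relation and yields the
Hamiltonian branch `(−p)σ(x) − (2δ/(2m+1))(−p)^((2m+1)/2) + δ`. -/
theorem generalized_branched_hamiltonian
    (m δ : ℝ) (hm0 : 0 ≤ m) (hm1 : m < 1 / 2) (hδ : 0 < δ)
    (σ : ℝ → ℝ) (x p : ℝ) (hp : p < 0) :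
    let Λ : ℝ := ((1 - 2 * m) / (1 + 2 * m)) * δ ^ ((2 : ℝ) / (1 - 2 * m))
    let v : ℝ := -σ x + δ * (-p) ^ ((2 * m - 1) / 2)
    0 < v + σ x ∧
    -δ ^ ((2 : ℝ) / (1 - 2 * m)) * (v + σ x) ^ ((2 : ℝ) / (2 * m - 1)) = p ∧
    p * v - (Λ * (v + σ x) ^ ((2 * m + 1) / (2 * m - 1)) - δ)
        = (-p) * σ x - (2 * δ / (2 * m + 1)) * (-p) ^ ((2 * m + 1) / 2) + δ := by
  intro Λ v
  have hq : 0 < -p := neg_pos.mpr hp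
  have hm : 2 * m - 1 ≠ 0 := by linarith
  have hm' : 1 - 2 * m ≠ 0 := by linarith
  have hm2 : 2 * m + 1 ≠ 0 := by linarith
  have hm2' : 1 + 2 * m ≠ 0 := by linarith
  have hw : v + σ x = δ * (-p) ^ ((2 * m - 1) / 2) := by
    simp only [v]
    ring
  have hpow (r : ℝ) :
      (v + σ x) ^ r = δ ^ r * (-p) ^ ((2 * m - 1) / 2 * r) := by
    rw [hw, Real.mul_rpow hδ.le (Real.rpow_nonneg hq.le _), ← Real.rpow_mul hq.le]
  refine ⟨hw ▸ by positivity, ?_, ?_⟩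
  · have hexp : (2 * m - 1) / 2 * (2 / (2 * m - 1)) = 1 := by field_simp
    have hδpow : δ ^ (2 / (1 - 2 * m)) * δ ^ (2 / (2 * m - 1)) = 1 := by
      rw [← Real.rpow_add hδ, ← neg_sub (2 * m) 1, div_neg, neg_add_cancel, Real.rpow_zero]
    rw [hpow, hexp, Real.rpow_one]
    linear_combination p * hδpow
  · have hexp : (2 * m - 1) / 2 * ((2 * m + 1) / (2 * m - 1)) = (2 * m + 1) / 2 := by
      field_simp
    have hδpow : δ ^ (2 / (1 - 2 * m)) * δ ^ ((2 * m + 1) / (2 * m - 1)) = δ := by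
      have hsum : 2 / (1 - 2 * m) + (2 * m + 1) / (2 * m - 1) = 1 := by
        rw [← neg_sub (2 * m) 1, div_neg, neg_add_eq_sub, ← sub_div, div_eq_one_iff_eq hm]
        ring
      rw [← Real.rpow_add hδ, hsum, Real.rpow_one]
    have hppow : (-p) ^ ((2 * m + 1) / 2) = -p * (-p) ^ ((2 * m - 1) / 2) := by
      rw [show (2 * m + 1) / 2 = 1 + (2 * m - 1) / 2 by ring, Real.rpow_add hq, Real.rpow_one]
    have hcoef : 1 + (1 - 2 * m) / (1 + 2 * m) = 2 / (2 * m + 1) := by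
      rw [add_comm (2 * m) 1]
      field_simp
      ring
    rw [hpow, hexp]
    simp only [Λ, v]
    linear_combination
      -(1 - 2 * m) / (1 + 2 * m) * (-p) ^ ((2 * m + 1) / 2) * hδpow
        + δ * hppow - δ * (-p) ^ ((2 * m + 1) / 2) * hcoef
end

section
/- Let s > 0 and λ be real numbers, and consider the reciprocal Lagrangian L(x,v) = (1/s)·((s/3)x² + (3/s)λ − v)⁻¹ with (s/3)x² + (3/s)λ − v ≠ 0. For every p > 0 and every real x, the two velocities v± = (s/3)x² + (3/s)λ ∓ 1/√(sp) satisfy: (i) the momentum relation (1/s)·((s/3)x² + (3/s)λ − v±)⁻² = p; and (ii) the Legendre-transform values giving the two Hamiltonian branches p·v± − L(x, v±) = (s/3)·x²·p + (3/s)·λ·p ∓ 2·√(p/s). -/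
/-- For positive `s`, the square root of a quotient is `√(s * p)` divided by `s`. -/
theorem sqrt_div_eq_sqrt_mul_div {s : ℝ} (hs : 0 < s) (p : ℝ) :
    Real.sqrt (p / s) = Real.sqrt (s * p) / s := by
  have h : p / s = s * p / s ^ 2 := by field_simp
  rw [h, Real.sqrt_div' _ (sq_nonneg s), Real.sqrt_sq hs.le]

/-- For the reciprocal Lagrangian
`L(x,v) = (1/s)((s/3)x² + (3/s)λ − v)⁻¹`, the two velocities
`v± = (s/3)x² + (3/s)λ ∓ 1/√(sp)` satisfy the momentum relation
`(1/s)((s/3)x² + (3/s)λ − v±)⁻² = p` and give the two Hamiltonian branches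
`(s/3)x²p + (3/s)λp ∓ 2√(p/s)`. -/
theorem reciprocal_lagrangian_final_example
    (s lam x p : ℝ) (hs : 0 < s) (hp : 0 < p) :
    let D : ℝ := (s / 3) * x ^ 2 + (3 / s) * lam
    let vp : ℝ := D - 1 / Real.sqrt (s * p)
    let vm : ℝ := D + 1 / Real.sqrt (s * p)
    ((1 / s) * ((D - vp) ^ 2)⁻¹ = p ∧ (1 / s) * ((D - vm) ^ 2)⁻¹ = p) ∧
    (p * vp - (1 / s) * (D - vp)⁻¹
        = (s / 3) * x ^ 2 * p + (3 / s) * lam * p - 2 * Real.sqrt (p / s) ∧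
      p * vm - (1 / s) * (D - vm)⁻¹
        = (s / 3) * x ^ 2 * p + (3 / s) * lam * p + 2 * Real.sqrt (p / s)) := by
  intro D vp vm
  have hr : 0 < Real.sqrt (s * p) := Real.sqrt_pos.2 (mul_pos hs hp)
  have hsq : Real.sqrt (s * p) ^ 2 = s * p := Real.sq_sqrt (mul_pos hs hp).le
  rw [sqrt_div_eq_sqrt_mul_div hs]
  have hvp : D - vp = (Real.sqrt (s * p))⁻¹ := by simp [vp]
  have hvm : D - vm = -(Real.sqrt (s * p))⁻¹ := by simp [vm]
  have hdiv : p / Real.sqrt (s * p) = Real.sqrt (s * p) / s := by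
    rw [div_eq_div_iff hr.ne' hs.ne']
    linear_combination -hsq
  have hmom : 1 / s * Real.sqrt (s * p) ^ 2 = p := by
    rw [hsq]
    field_simp
  rw [hvp, hvm, neg_sq, inv_pow, inv_inv, inv_neg, inv_inv]
  refine ⟨⟨hmom, hmom⟩, ?_, ?_⟩
  · simp only [vp, D]
    linear_combination -hdiv
  · simp only [vm, D]
    linear_combination hdiv
end
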